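/- Let ρ be a positive semidefinite Hermitian multipartite state of trace 1 on n parties (with arbitrary finite local dimensions), n ≥ 2, and denote by ρ_i and ρ_{ij} its one- and two-body reductions. Then (n−1) · ∑_{i} S_L(ρ_i) − ∑_{i<j} S_L(ρ_{ij}) ≥ 0, where S_L(σ) = 2(1 − tr(σ²)) is the linear entropy. Equivalently, ∑_{i<j} ( 1 − tr(ρ_i²) − tr(ρ_j²) + tr(ρ_{ij}²) ) ≥ 0. -/

import Mathlib

open Finset

/-- Combine an assignment on `S` with an assignment on its complement. -/
def combineOn {n : ℕ} {d : Fin n → ℕ} (S : Finset (Fin n))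
    (a : ∀ i : {i : Fin n // i ∈ S}, Fin (d i))
    (b : ∀ i : {i : Fin n // i ∉ S}, Fin (d i)) : ∀ i, Fin (d i) :=
  fun i => if h : i ∈ S then a ⟨i, h⟩ else b ⟨i, h⟩

/-- The reduction `ρ_S` of a multipartite operator onto the subset `S` of parties,
obtained by tracing out the parties outside `S`. -/
noncomputable def reduceTo {n : ℕ} {d : Fin n → ℕ}
    (ρ : Matrix (∀ i, Fin (d i)) (∀ i, Fin (d i)) ℂ) (S : Finset (Fin n)) :
    Matrix (∀ i : {i : Fin n // i ∈ S}, Fin (d i))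
           (∀ i : {i : Fin n // i ∈ S}, Fin (d i)) ℂ :=
  Matrix.of fun a a' => ∑ b : ∀ i : {i : Fin n // i ∉ S}, Fin (d i),
    ρ (combineOn S a b) (combineOn S a' b)

/-- The linear entropy `S_L(σ) = 2(1 - tr(σ²))`. -/
noncomputable def linEnt {α : Type} [Fintype α] (σ : Matrix α α ℂ) : ℂ :=
  2 * (1 - (σ * σ).trace)

/-- The permutation of pairs of assignments that exchanges the coordinates in `S`. -/
def swapOn {n : ℕ} {d : Fin n → ℕ} (S : Finset (Fin n)) :
    Equiv.Perm ((∀ i, Fin (d i)) × (∀ i, Fin (d i))) where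
  toFun z := (S.piecewise z.2 z.1, S.piecewise z.1 z.2)
  invFun z := (S.piecewise z.2 z.1, S.piecewise z.1 z.2)
  left_inv z := by ext i <;> by_cases h : i ∈ S <;> simp [h]
  right_inv z := by ext i <;> by_cases h : i ∈ S <;> simp [h]

theorem swapOn_mul_self {n : ℕ} {d : Fin n → ℕ} (S : Finset (Fin n)) :
    swapOn (d := d) S * swapOn S = 1 :=
  Equiv.ext (swapOn S).left_inv

theorem swapOn_mul_of_disjoint {n : ℕ} {d : Fin n → ℕ} {S T : Finset (Fin n)}
    (h : Disjoint S T) : swapOn (d := d) S * swapOn T = swapOn (S ∪ T) := by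
  refine Equiv.ext fun z => ?_
  ext i <;> by_cases hS : i ∈ S <;> by_cases hT : i ∈ T <;>
    first
    | exact absurd hT (Finset.disjoint_left.mp h hS)
    | simp [swapOn, hS, hT]

/-- The purity of a reduction is the expectation of a partial swap on two copies. -/
theorem trace_reduceTo_mul_self {n : ℕ} {d : Fin n → ℕ}
    (ρ : Matrix (∀ i, Fin (d i)) (∀ i, Fin (d i)) ℂ) (S : Finset (Fin n)) :
    (reduceTo ρ S * reduceTo ρ S).trace =
      ∑ z, Matrix.kroneckerMap (· * ·) ρ ρ z (swapOn S z) := by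
  let e := (Equiv.piEquivPiSubtypeProd (· ∈ S) fun i => Fin (d i)).symm
  have hsw (a a' b b') : swapOn S (combineOn (d := d) S a b, combineOn S a' b') =
      (combineOn S a' b, combineOn S a b') := by
    ext i <;> by_cases h : i ∈ S <;> simp [swapOn, combineOn, h]
  rw [← (e.prodCongr e).sum_comp]
  change _ = ∑ z : (_ × _) × (_ × _), Matrix.kroneckerMap (· * ·) ρ ρ
    (combineOn S z.1.1 z.1.2, combineOn S z.2.1 z.2.2)
    (swapOn S (combineOn S z.1.1 z.1.2, combineOn S z.2.1 z.2.2))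
  simp only [hsw, Matrix.kroneckerMap_apply, Fintype.sum_prod_type, Matrix.trace,
    Matrix.diag_apply, Matrix.mul_apply, reduceTo, Matrix.of_apply, Finset.sum_mul_sum]
  exact Finset.sum_congr rfl fun a _ => Finset.sum_comm

open scoped ComplexOrder in
/-- Pairing a positive semidefinite matrix with `(1 - σ)(1 - τ)`, for commuting involutions
`σ` and `τ` of the index type, gives a nonnegative number. -/
theorem sum_sub_perm_nonneg {ι : Type*} [Fintype ι] [DecidableEq ι]
    {M : Matrix ι ι ℂ} (hM : M.PosSemidef) {σ τ : Equiv.Perm ι}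
    (hσ : σ * σ = 1) (hτ : τ * τ = 1) (h : Commute σ τ) :
    0 ≤ ∑ z, M z z - ∑ z, M z (σ z) - ∑ z, M z (τ z) + ∑ z, M z ((σ * τ) z) := by
  have htrace (π : Equiv.Perm ι) (hπ : π * π = 1) :
      (M * π.permMatrix ℂ).trace = ∑ z, M z (π z) := by
    have : π.symm = π := inv_eq_of_mul_eq_one_left hπ
    simp [Matrix.trace, Equiv.Perm.permMatrix, PEquiv.mul_toMatrix_toPEquiv, this]
  have hherm (π : Equiv.Perm ι) (hπ : π * π = 1) :
      (π.permMatrix ℂ).conjTranspose = π.permMatrix ℂ := by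
    rw [Matrix.conjTranspose_permMatrix, inv_eq_of_mul_eq_one_left hπ]
  set A := σ.permMatrix ℂ with hA
  set B := τ.permMatrix ℂ with hB
  have hAA : A * A = 1 := by rw [hA, ← Matrix.permMatrix_mul, hσ, Matrix.permMatrix_one]
  have hBB : B * B = 1 := by rw [hB, ← Matrix.permMatrix_mul, hτ, Matrix.permMatrix_one]
  have hBA : B * A = (σ * τ).permMatrix ℂ := by rw [Matrix.permMatrix_mul]
  have hAB : A * B = B * A := by rw [hBA, h.eq, Matrix.permMatrix_mul]
  have hAdj : ((1 - A) * (1 - B)).conjTranspose = (1 - A) * (1 - B) := by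
    rw [Matrix.conjTranspose_mul, Matrix.conjTranspose_sub, Matrix.conjTranspose_sub,
      hherm σ hσ, hherm τ hτ, Matrix.conjTranspose_one]
    linear_combination (norm := noncomm_ring) -hAB
  have hsq : (1 - A) * (1 - B) * ((1 - A) * (1 - B)) = 4 • ((1 - A) * (1 - B)) := by
    have hc : (1 - B) * (1 - A) = (1 - A) * (1 - B) := by
      linear_combination (norm := noncomm_ring) -hAB
    have hA2 : (1 - A) * (1 - A) = 2 • (1 - A) := by
      linear_combination (norm := noncomm_ring) hAA
    have hB2 : (1 - B) * (1 - B) = 2 • (1 - B) := by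
      linear_combination (norm := noncomm_ring) hBB
    rw [mul_assoc, ← mul_assoc (1 - B), hc, mul_assoc, hB2, ← mul_assoc, hA2,
      smul_mul_smul_comm]
  have hστ : σ * τ * (σ * τ) = 1 := by
    rw [mul_assoc, ← mul_assoc τ, ← h.eq, mul_assoc σ, hτ, mul_one, hσ]
  have hpos := (hM.conjTranspose_mul_mul_same ((1 - A) * (1 - B))).trace_nonneg
  rw [hAdj, Matrix.trace_mul_comm, ← mul_assoc, hsq, Matrix.trace_mul_comm] at hpos
  have hexp : (M * (4 • ((1 - A) * (1 - B)))).trace = 4 * (∑ z, M z z - ∑ z, M z (σ z)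
      - ∑ z, M z (τ z) + ∑ z, M z ((σ * τ) z)) := by
    rw [← htrace σ hσ, ← htrace τ hτ, ← htrace _ hστ, ← hBA, ← hAB, mul_smul_comm,
      Matrix.trace_smul, sub_mul, mul_sub, mul_sub, one_mul, one_mul]
    simp only [mul_sub, Matrix.trace_sub, mul_one, nsmul_eq_mul]
    simp only [Matrix.trace, Matrix.diag_apply]
    push_cast
    ring
  rw [hexp] at hpos
  simpa using mul_nonneg (inv_nonneg.mpr (zero_le_four (α := ℂ))) hpos

open scoped ComplexOrder in
/-- Subadditivity of the linear entropy for disjoint sets of parties. -/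
theorem linEnt_reduceTo_union_le {n : ℕ} {d : Fin n → ℕ}
    {ρ : Matrix (∀ i, Fin (d i)) (∀ i, Fin (d i)) ℂ}
    (hρ : ρ.PosSemidef) (htr : ρ.trace = 1) {S T : Finset (Fin n)} (h : Disjoint S T) :
    linEnt (reduceTo ρ (S ∪ T)) ≤ linEnt (reduceTo ρ S) + linEnt (reduceTo ρ T) := by
  have hcomm : Commute (swapOn (d := d) S) (swapOn T) := by
    rw [Commute, SemiconjBy, swapOn_mul_of_disjoint h, swapOn_mul_of_disjoint h.symm,
      Finset.union_comm]
  have key := sum_sub_perm_nonneg (hρ.kronecker hρ)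
    (swapOn_mul_self S) (swapOn_mul_self T) hcomm
  have hone : ∑ z, Matrix.kroneckerMap (· * ·) ρ ρ z z = 1 := 
    (Matrix.trace_kronecker ρ ρ).trans (by rw [htr, one_mul])
  rw [swapOn_mul_of_disjoint h, hone, ← trace_reduceTo_mul_self, ← trace_reduceTo_mul_self,
    ← trace_reduceTo_mul_self] at key
  rw [← sub_nonneg]
  convert mul_nonneg (zero_le_two (α := ℂ)) key using 1
  simp only [linEnt]
  ring

/-- Each index of an `n`-element set occurs in `n - 1` pairs. -/
theorem sum_lt_pairs_add {n : ℕ} {R : Type*} [CommRing R] (f : Fin n → R) :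
    ∑ p ∈ Finset.univ.filter (fun p : Fin n × Fin n => p.1 < p.2), (f p.1 + f p.2) =
      ((n : R) - 1) * ∑ i, f i := by
  have hswap : ∑ p ∈ Finset.univ.filter (fun p : Fin n × Fin n => p.1 < p.2), f p.2 =
      ∑ p ∈ Finset.univ.filter (fun p : Fin n × Fin n => p.2 < p.1), f p.1 :=
    Finset.sum_equiv (Equiv.prodComm _ _) (by simp) (by simp)
  have hsplit (i j : Fin n) : ((if i < j then f i else 0) + if j < i then f i else 0) =
      f i - if i = j then f i else 0 := by
    rcases lt_trichotomy i j with h | rfl | h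
    · simp [h, h.not_gt, h.ne]
    · simp
    · simp [h, h.not_gt, h.ne']
  rw [Finset.sum_add_distrib, hswap, Finset.sum_filter, Finset.sum_filter,
    ← Finset.sum_add_distrib, Fintype.sum_prod_type]
  simp [hsplit, Finset.sum_sub_distrib, ← Finset.mul_sum, sub_mul]

open scoped ComplexOrder in
/-- Monogamy-like relation for linear entropies of one- and two-body reductions:
for a multipartite state `ρ` on `n ≥ 2` parties,
`(n-1) ∑_i S_L(ρ_i) - ∑_{i<j} S_L(ρ_{ij}) ≥ 0`. -/
theorem linEnt_one_two_body {n : ℕ} (hn : 2 ≤ n) (d : Fin n → ℕ) (hd : ∀ i, 1 ≤ d i)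
    (ρ : Matrix (∀ i, Fin (d i)) (∀ i, Fin (d i)) ℂ)
    (hρ : ρ.PosSemidef) (htr : ρ.trace = 1) :
    0 ≤ ((n : ℂ) - 1) * (∑ i : Fin n, linEnt (reduceTo ρ {i}))
        - ∑ p ∈ Finset.univ.filter (fun p : Fin n × Fin n => p.1 < p.2),
            linEnt (reduceTo ρ {p.1, p.2}) := by
  rw [← sum_lt_pairs_add, ← Finset.sum_sub_distrib]
  refine Finset.sum_nonneg fun p hp => sub_nonneg.mpr ?_
  rw [Finset.insert_eq]
  exact linEnt_reduceTo_union_le hρ htr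
    (Finset.disjoint_singleton.mpr (Finset.mem_filter.mp hp).2.ne)
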